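/- Assume q ≠ 0 and let H_q = VᵀHV be positive definite, where V ∈ ℝ^{n×(n−1)} has orthonormal columns spanning {q}^⊥. Let x ∈ Ω satisfy ‖β(x)‖_∞ > κ(H_q)^{1/2} ‖φ(x)‖₂, where κ(H_q) = ζ_max(H_q)/ζ_min(H_q), and let x̄ be the (unique) minimizer of f over Ω(x). If x̄ ∈ Ω, then β(x̄) ≠ 0. -/

import Mathlib

noncomputable section

open Matrix
open scoped Classical

/-- Euclidean dot product. -/
def dotp {m : Type*} [Fintype m] (v w : m → ℝ) : ℝ := ∑ i, v i * w i

/-- Euclidean norm. -/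
def nrm {m : Type*} [Fintype m] (v : m → ℝ) : ℝ := Real.sqrt (∑ i, (v i) ^ 2)

/-- Objective f(x) = ½ xᵀHx − cᵀx. -/
def fObj {n : ℕ} (H : Matrix (Fin n) (Fin n) ℝ) (c x : Fin n → ℝ) : ℝ :=
  (1 / 2) * dotp x (H.mulVec x) - dotp c x

/-- Gradient ∇f(x) = Hx − c (for H symmetric). -/
def grad {n : ℕ} (H : Matrix (Fin n) (Fin n) ℝ) (c x : Fin n → ℝ) : Fin n → ℝ :=
  H.mulVec x - c

/-- Feasible set Ω = {x : qᵀx = b, l ≤ x ≤ u}. -/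
def OmegaSet {n : ℕ} (q : Fin n → ℝ) (b : ℝ) (l u : Fin n → ℝ) : Set (Fin n → ℝ) :=
  {x | dotp q x = b ∧ ∀ i, l i ≤ x i ∧ x i ≤ u i}

/-- Lower active set A_l(x). -/
def Al {n : ℕ} (l x : Fin n → ℝ) : Set (Fin n) := {i | x i = l i}

/-- Upper active set A_u(x). -/
def Au {n : ℕ} (u x : Fin n → ℝ) : Set (Fin n) := {i | x i = u i}

/-- Active set A(x). -/
def ASet {n : ℕ} (l u x : Fin n → ℝ) : Set (Fin n) := Al l x ∪ Au u x

/-- Free set F(x). -/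
def FSet {n : ℕ} (l u x : Fin n → ℝ) : Set (Fin n) := (ASet l u x)ᶜ

/-- ρ(x) = q_Fᵀ(∇f(x))_F / q_Fᵀq_F (0 if q_F = 0). -/
def rhoF {n : ℕ} (H : Matrix (Fin n) (Fin n) ℝ) (c q l u x : Fin n → ℝ) : ℝ :=
  if ∀ i ∈ FSet l u x, q i = 0 then 0
  else (∑ i, if i ∈ FSet l u x then q i * grad H c x i else 0) /
    (∑ i, if i ∈ FSet l u x then q i * q i else 0)

/-- h(x) = ∇f(x) − ρ(x) q. -/
def hVec {n : ℕ} (H : Matrix (Fin n) (Fin n) ℝ) (c q l u x : Fin n → ℝ) : Fin n → ℝ :=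
  fun i => grad H c x i - rhoF H c q l u x * q i

/-- Free gradient φ(x). -/
def phiVec {n : ℕ} (H : Matrix (Fin n) (Fin n) ℝ) (c q l u x : Fin n → ℝ) : Fin n → ℝ :=
  fun i => if i ∈ FSet l u x then hVec H c q l u x i else 0

/-- Tangent cone T_Ω(x). -/
def TCone {n : ℕ} (q l u x : Fin n → ℝ) : Set (Fin n → ℝ) :=
  {v | dotp q v = 0 ∧ (∀ i ∈ Al l x, 0 ≤ v i) ∧ (∀ i ∈ Au u x, v i ≤ 0)}

/-- g is the projected gradient ∇_Ω f(x): the minimizer of ‖v + ∇f(x)‖ over v ∈ T_Ω(x). -/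
def IsProjGrad {n : ℕ} (H : Matrix (Fin n) (Fin n) ℝ) (c q l u x g : Fin n → ℝ) : Prop :=
  g ∈ TCone q l u x ∧ ∀ v ∈ TCone q l u x, nrm (g + grad H c x) ≤ nrm (v + grad H c x)

/-- Chopped gradient β(x) = −∇_Ω f(x) − φ(x), where g = ∇_Ω f(x). -/
def betaVec {n : ℕ} (H : Matrix (Fin n) (Fin n) ℝ) (c q l u x g : Fin n → ℝ) : Fin n → ℝ :=
  -g - phiVec H c q l u x

/-- Binding set B(x). -/
def BSet {n : ℕ} (H : Matrix (Fin n) (Fin n) ℝ) (c q l u x : Fin n → ℝ) : Set (Fin n) :=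
  {i | (i ∈ Al l x ∧ 0 ≤ hVec H c q l u x i) ∨ (i ∈ Au u x ∧ hVec H c q l u x i ≤ 0)}

/-- Affine closure Ω(x) of the face determined by the active set at x. -/
def OmegaFace {n : ℕ} (q : Fin n → ℝ) (b : ℝ) (l u x : Fin n → ℝ) : Set (Fin n → ℝ) :=
  {v | dotp q v = b ∧ ∀ i ∈ ASet l u x, v i = x i}

/-- Ω₀(x). -/
def Omega0 {n : ℕ} (q l u x : Fin n → ℝ) : Set (Fin n → ℝ) :=
  {v | dotp q v = 0 ∧ ∀ i ∈ ASet l u x, v i = 0}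

/-- KKT stationarity: ∇f(x) = Σ_{i∈A(x)} λᵢ eᵢ + ρ q with sign conditions. -/
def Stationary {n : ℕ} (H : Matrix (Fin n) (Fin n) ℝ) (c q : Fin n → ℝ) (b : ℝ)
    (l u x : Fin n → ℝ) : Prop :=
  x ∈ OmegaSet q b l u ∧
    ∃ (ρs : ℝ) (lam : Fin n → ℝ),
      (∀ i, grad H c x i = lam i + ρs * q i) ∧
      (∀ i ∈ FSet l u x, lam i = 0) ∧
      (∀ i ∈ Al l x, 0 ≤ lam i) ∧ (∀ i ∈ Au u x, lam i ≤ 0)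

/-- Lagrange multiplier estimate λ(x). -/
def lamEst {n : ℕ} (H : Matrix (Fin n) (Fin n) ℝ) (c q l u x : Fin n → ℝ) : Fin n → ℝ :=
  fun i =>
    if i ∈ Al l x then max 0 (hVec H c q l u x i)
    else if i ∈ Au u x then min 0 (hVec H c q l u x i) else 0

/-- ζ is the smallest eigenvalue of M. -/
def IsSmallestEigenvalue {m : Type*} [Fintype m] (M : Matrix m m ℝ) (ζ : ℝ) : Prop :=
  (∃ v : m → ℝ, v ≠ 0 ∧ M.mulVec v = ζ • v) ∧
    ∀ (μ : ℝ) (v : m → ℝ), v ≠ 0 → M.mulVec v = μ • v → ζ ≤ μ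

/-- ζ is the largest eigenvalue of M. -/
def IsLargestEigenvalue {m : Type*} [Fintype m] (M : Matrix m m ℝ) (ζ : ℝ) : Prop :=
  (∃ v : m → ℝ, v ≠ 0 ∧ M.mulVec v = ζ • v) ∧
    ∀ (μ : ℝ) (v : m → ℝ), v ≠ 0 → M.mulVec v = μ • v → μ ≤ ζ

/-- t is the spectral (ℓ₂ operator) norm of M. -/
def IsSpectralNorm {m k : Type*} [Fintype m] [Fintype k] (M : Matrix m k ℝ) (t : ℝ) : Prop :=
  IsLeast {s : ℝ | 0 ≤ s ∧ ∀ v : k → ℝ, nrm (M.mulVec v) ≤ s * nrm v} t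

/-- A quadratic form without constant term that is nonnegative for small positive arguments has
nonnegative linear coefficient. -/
lemma linear_coeff_nonneg {a b : ℝ} (h : ∀ t : ℝ, 0 < t → t ≤ 1 → 0 ≤ t * a + t ^ 2 * b) :
    0 ≤ a := by
  by_contra! ha
  have hb : 0 ≤ |b| := abs_nonneg b
  have hs : 0 < -a / (|b| + -a + 1) := div_pos (by linarith) (by linarith)
  have h1 := h _ hs ((div_le_one (by linarith)).2 (by linarith))
  set s := -a / (|b| + -a + 1) with hs_def
  have hsb : s * (|b| + -a + 1) = -a := div_mul_cancel₀ _ (by linarith)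
  have h2 : 0 ≤ s * (a + s * b) := by linarith
  have h3 := nonneg_of_mul_nonneg_right h2 hs
  nlinarith [mul_le_mul_of_nonneg_left (le_abs_self b) hs.le, mul_pos hs (neg_pos.2 ha)]

lemma dotp_eq_dotProduct {m : Type*} [Fintype m] (v w : m → ℝ) : dotp v w = v ⬝ᵥ w := rfl

lemma nrm_eq_sqrt_dotProduct {m : Type*} [Fintype m] (v : m → ℝ) : nrm v = √(v ⬝ᵥ v) := by
  simp only [nrm, dotProduct, pow_two]

lemma dotProduct_self_nonneg_real {m : Type*} [Fintype m] (v : m → ℝ) : 0 ≤ v ⬝ᵥ v :=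
  Finset.sum_nonneg fun i _ => mul_self_nonneg (v i)

lemma nrm_nonneg {m : Type*} [Fintype m] (v : m → ℝ) : 0 ≤ nrm v := Real.sqrt_nonneg _

lemma nrm_sq {m : Type*} [Fintype m] (v : m → ℝ) : nrm v ^ 2 = v ⬝ᵥ v := by
  rw [nrm_eq_sqrt_dotProduct, Real.sq_sqrt (dotProduct_self_nonneg_real v)]

lemma abs_apply_le_nrm {m : Type*} [Fintype m] (v : m → ℝ) (i : m) : |v i| ≤ nrm v :=
  Real.abs_le_sqrt (Finset.single_le_sum (f := fun j => v j ^ 2) (fun _ _ => sq_nonneg _)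
    (Finset.mem_univ i))

lemma dotProduct_mulVec_comm_of_isSymm {m : Type*} [Fintype m] {M : Matrix m m ℝ}
    (hM : M.IsSymm) (v w : m → ℝ) : v ⬝ᵥ M *ᵥ w = w ⬝ᵥ M *ᵥ v := by
  rw [dotProduct_mulVec, dotProduct_comm, ← mulVec_transpose, hM.eq]

lemma fObj_add {n : ℕ} {H : Matrix (Fin n) (Fin n) ℝ} (hH : H.IsSymm) (c x v : Fin n → ℝ) :
    fObj H c (x + v) = fObj H c x + grad H c x ⬝ᵥ v + 1 / 2 * (v ⬝ᵥ H *ᵥ v) := by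
  simp only [fObj, grad, dotp_eq_dotProduct, mulVec_add, add_dotProduct, dotProduct_add,
    sub_dotProduct]
  rw [dotProduct_mulVec_comm_of_isSymm hH v x, dotProduct_comm (H *ᵥ x) v,
    dotProduct_mulVec_comm_of_isSymm hH v x]
  ring

section ProjectedGradient

variable {n : ℕ} {H : Matrix (Fin n) (Fin n) ℝ} {c q l u x g : Fin n → ℝ}

lemma IsProjGrad.dotProduct_nonneg_of_feasible (hg : IsProjGrad H c q l u x g) {v : Fin n → ℝ}
    (hv : ∀ t : ℝ, 0 < t → t ≤ 1 → g + t • v ∈ TCone q l u x) :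
    0 ≤ (g + grad H c x) ⬝ᵥ v := by
  have key : 0 ≤ 2 * ((g + grad H c x) ⬝ᵥ v) := by
    refine linear_coeff_nonneg (b := v ⬝ᵥ v) fun t ht ht1 => ?_
    have h := hg.2 _ (hv t ht ht1)
    have h2 := pow_le_pow_left₀ (nrm_nonneg _) h 2
    rw [nrm_sq, nrm_sq, add_right_comm g] at h2
    set r := g + grad H c x
    simp only [add_dotProduct, dotProduct_add, smul_dotProduct, dotProduct_smul, smul_eq_mul,
      dotProduct_comm v r] at h2
    nlinarith
  linarith

lemma TCone.add_mem {v w : Fin n → ℝ} (hv : v ∈ TCone q l u x) (hw : w ∈ TCone q l u x) :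
    v + w ∈ TCone q l u x := by
  refine ⟨?_, fun i hi => add_nonneg (hv.2.1 i hi) (hw.2.1 i hi),
    fun i hi => add_nonpos (hv.2.2 i hi) (hw.2.2 i hi)⟩
  have h1 := hv.1
  have h2 := hw.1
  rw [dotp_eq_dotProduct] at *
  rw [dotProduct_add, h1, h2, add_zero]

lemma TCone.smul_mem {v : Fin n → ℝ} (hv : v ∈ TCone q l u x) {t : ℝ} (ht : 0 ≤ t) :
    t • v ∈ TCone q l u x := by
  refine ⟨?_, fun i hi => mul_nonneg ht (hv.2.1 i hi),
    fun i hi => mul_nonpos_of_nonneg_of_nonpos ht (hv.2.2 i hi)⟩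
  have h1 := hv.1
  rw [dotp_eq_dotProduct] at *
  rw [dotProduct_smul, h1, smul_zero]

lemma Omega0.mem_TCone {v : Fin n → ℝ} (hv : v ∈ Omega0 q l u x) : v ∈ TCone q l u x :=
  ⟨hv.1, fun i hi => (hv.2 i (Or.inl hi)).ge, fun i hi => (hv.2 i (Or.inr hi)).le⟩

lemma Omega0.smul_mem {v : Fin n → ℝ} (hv : v ∈ Omega0 q l u x) (t : ℝ) :
    t • v ∈ Omega0 q l u x := by
  refine ⟨?_, fun i hi => by simp [hv.2 i hi]⟩
  have h1 := hv.1
  rw [dotp_eq_dotProduct] at *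
  rw [dotProduct_smul, h1, smul_zero]

lemma IsProjGrad.dotProduct_nonneg (hg : IsProjGrad H c q l u x g) {v : Fin n → ℝ}
    (hv : v ∈ TCone q l u x) : 0 ≤ (g + grad H c x) ⬝ᵥ v :=
  hg.dotProduct_nonneg_of_feasible fun _ ht _ => TCone.add_mem hg.1 (TCone.smul_mem hv ht.le)

lemma IsProjGrad.dotProduct_eq_zero (hg : IsProjGrad H c q l u x g) {v : Fin n → ℝ}
    (hv : v ∈ Omega0 q l u x) : (g + grad H c x) ⬝ᵥ v = 0 := by
  have h1 := hg.dotProduct_nonneg (Omega0.mem_TCone hv)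
  have h2 := hg.dotProduct_nonneg (Omega0.mem_TCone (Omega0.smul_mem hv (-1)))
  rw [dotProduct_smul, smul_eq_mul] at h2
  linarith

lemma IsProjGrad.grad_dotProduct_self (hg : IsProjGrad H c q l u x g) :
    grad H c x ⬝ᵥ g = -(g ⬝ᵥ g) := by
  have h1 := hg.dotProduct_nonneg hg.1
  have h2 : 0 ≤ (g + grad H c x) ⬝ᵥ (-g) := by
    refine hg.dotProduct_nonneg_of_feasible fun t _ ht1 => ?_
    have : g + t • -g = (1 - t) • g := by module
    rw [this]
    exact TCone.smul_mem hg.1 (by linarith)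
  rw [dotProduct_neg] at h2
  rw [add_dotProduct] at *
  linarith

variable (H c q l u x)

lemma phiVec_mem_Omega0 : phiVec H c q l u x ∈ Omega0 q l u x := by
  refine ⟨?_, fun i hi => by simp [phiVec, FSet, hi]⟩
  by_cases h : ∀ i ∈ FSet l u x, q i = 0
  · refine Finset.sum_eq_zero fun i _ => ?_
    by_cases hi : i ∈ FSet l u x
    · simp [h i hi]
    · simp [phiVec, hi]
  · have hpos : (∑ i, if i ∈ FSet l u x then q i * q i else 0) ≠ 0 := by
      push Not at h
      obtain ⟨j, hj, hqj⟩ := h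
      refine (Finset.sum_pos' (fun i _ => ?_) ⟨j, Finset.mem_univ j, ?_⟩).ne'
      · split_ifs
        · exact mul_self_nonneg _
        · exact le_rfl
      · simpa [hj] using mul_self_pos.2 hqj
    have hρ : rhoF H c q l u x * (∑ i, if i ∈ FSet l u x then q i * q i else 0) =
        ∑ i, if i ∈ FSet l u x then q i * grad H c x i else 0 := by
      rw [rhoF, if_neg h, div_mul_cancel₀ _ hpos]
    have : dotp q (phiVec H c q l u x) =
        (∑ i, if i ∈ FSet l u x then q i * grad H c x i else 0) -
          rhoF H c q l u x * (∑ i, if i ∈ FSet l u x then q i * q i else 0) := by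
      rw [Finset.mul_sum, ← Finset.sum_sub_distrib]
      refine Finset.sum_congr rfl fun i _ => ?_
      by_cases hi : i ∈ FSet l u x
      · simp only [phiVec, hVec, hi, if_true]
        ring
      · simp [phiVec, hi]
    rw [this, hρ, sub_self]

variable {q l u x}

lemma grad_dotProduct_of_mem_Omega0 {v : Fin n → ℝ} (hv : v ∈ Omega0 q l u x) :
    grad H c x ⬝ᵥ v = phiVec H c q l u x ⬝ᵥ v := by
  have h : grad H c x ⬝ᵥ v =
      phiVec H c q l u x ⬝ᵥ v + rhoF H c q l u x * dotp q v := by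
    simp only [dotp, dotProduct, Finset.mul_sum, ← Finset.sum_add_distrib]
    refine Finset.sum_congr rfl fun i _ => ?_
    by_cases hi : i ∈ ASet l u x
    · simp [hv.2 i hi]
    · have hi' : i ∈ FSet l u x := hi
      simp only [phiVec, hVec, hi', if_true]
      ring
  rw [h, hv.1, mul_zero, add_zero]

variable {H c}

lemma IsProjGrad.nrm_betaVec_le (hg : IsProjGrad H c q l u x g) :
    nrm (betaVec H c q l u x g) ≤ nrm g := by
  have hφ := phiVec_mem_Omega0 H c q l u x
  have h1 := hg.dotProduct_eq_zero hφ
  have h2 := grad_dotProduct_of_mem_Omega0 H c hφ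
  have h3 := dotProduct_self_nonneg_real (phiVec H c q l u x)
  rw [nrm_eq_sqrt_dotProduct, nrm_eq_sqrt_dotProduct]
  refine Real.sqrt_le_sqrt ?_
  rw [add_dotProduct, h2] at h1
  simp only [betaVec, sub_dotProduct, dotProduct_sub, neg_dotProduct, dotProduct_neg]
  rw [dotProduct_comm (phiVec H c q l u x) g]
  linarith

end ProjectedGradient

section SpectralBounds

variable {m : Type*} [Fintype m] {M : Matrix m m ℝ} {ζ : ℝ}

lemma IsSmallestEigenvalue.mul_dotProduct_le (hM : M.IsHermitian)
    (hζ : IsSmallestEigenvalue M ζ) (y : m → ℝ) : ζ * (y ⬝ᵥ y) ≤ y ⬝ᵥ M *ᵥ y := by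
  have hN : (M - ζ • (1 : Matrix m m ℝ)).IsHermitian :=
    hM.sub (by simp [Matrix.IsHermitian])
  have hpsd : (M - ζ • (1 : Matrix m m ℝ)).PosSemidef := by
    refine hN.posSemidef_iff_eigenvalues_nonneg.2 fun i => ?_
    have h := hN.mulVec_eigenvectorBasis i
    have hne : (hN.eigenvectorBasis i).ofLp ≠ 0 := by
      simpa using hN.eigenvectorBasis.orthonormal.ne_zero i
    have := hζ.2 (hN.eigenvalues i + ζ) _ hne (by
      rw [sub_mulVec, smul_mulVec, one_mulVec, sub_eq_iff_eq_add] at h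
      rw [h, add_smul])
    simpa using this
  have h := hpsd.dotProduct_mulVec_nonneg y
  rw [sub_mulVec, smul_mulVec, one_mulVec, dotProduct_sub, dotProduct_smul] at h
  simpa using h

lemma IsLargestEigenvalue.dotProduct_le_mul (hM : M.IsHermitian)
    (hζ : IsLargestEigenvalue M ζ) (y : m → ℝ) : y ⬝ᵥ M *ᵥ y ≤ ζ * (y ⬝ᵥ y) := by
  have hneg : IsSmallestEigenvalue (-M) (-ζ) := by
    obtain ⟨⟨v, hv, hMv⟩, hmax⟩ := hζ
    refine ⟨⟨v, hv, by rw [neg_mulVec, hMv, neg_smul]⟩, fun μ w hw hMw => ?_⟩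
    rw [neg_mulVec, neg_eq_iff_eq_neg] at hMw
    linarith [hmax (-μ) w hw (by rw [hMw, neg_smul])]
  have h := hneg.mul_dotProduct_le hM.neg y
  rw [neg_mulVec, dotProduct_neg] at h
  linarith

lemma IsSmallestEigenvalue.pos_of_posDef (hM : M.PosDef) (hζ : IsSmallestEigenvalue M ζ) :
    0 < ζ := by
  obtain ⟨⟨v, hv, hMv⟩, -⟩ := hζ
  have h := hM.dotProduct_mulVec_pos hv
  rw [hMv, dotProduct_smul, smul_eq_mul] at h
  exact pos_of_mul_pos_left h (dotProduct_self_nonneg_real v)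

lemma IsSmallestEigenvalue.le_of_isLargestEigenvalue {ζ' : ℝ} (hζ : IsSmallestEigenvalue M ζ)
    (hζ' : IsLargestEigenvalue M ζ') : ζ ≤ ζ' := by
  obtain ⟨⟨v, hv, hMv⟩, -⟩ := hζ
  exact hζ'.2 _ v hv hMv

end SpectralBounds

lemma exists_mulVec_eq_of_dotProduct_eq_zero {n : ℕ} {q : Fin n → ℝ} (hq : q ≠ 0)
    {V : Matrix (Fin n) (Fin (n - 1)) ℝ} (hVorth : Vᵀ * V = 1) (hVq : Matrix.vecMul q V = 0)
    {v : Fin n → ℝ} (hv : q ⬝ᵥ v = 0) : ∃ y, v = V *ᵥ y := by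
  set L : Module.Dual ℝ (Fin n → ℝ) := dotProductBilin ℝ ℝ q with hL
  have hL0 : L ≠ 0 := fun h => hq (dotProduct_self_eq_zero.1 (LinearMap.congr_fun h q))
  have hker := Module.Dual.finrank_ker_add_one_of_ne_zero hL0
  have hinj : Function.Injective V.mulVecLin := by
    intro y z hyz
    have := congrArg (Vᵀ *ᵥ ·) hyz
    simpa [hVorth] using this
  have hrank := LinearMap.finrank_range_of_inj hinj
  have hle : LinearMap.range V.mulVecLin ≤ LinearMap.ker L := by
    rintro _ ⟨y, rfl⟩
    change q ⬝ᵥ V *ᵥ y = 0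
    rw [dotProduct_mulVec, hVq, zero_dotProduct]
  have heq := Submodule.eq_of_le_of_finrank_eq hle (by
    rw [hrank]
    simp only [Module.finrank_fin_fun] at hker ⊢
    omega)
  have hmem : v ∈ LinearMap.ker L := hv
  rw [← heq] at hmem
  obtain ⟨y, hy⟩ := hmem
  exact ⟨y, hy.symm⟩

lemma dotProduct_mulVec_bounds {n : ℕ} {H : Matrix (Fin n) (Fin n) ℝ} {q : Fin n → ℝ}
    (hq : q ≠ 0) {V : Matrix (Fin n) (Fin (n - 1)) ℝ} (hVorth : Vᵀ * V = 1)
    (hVq : Matrix.vecMul q V = 0) (hHq : (Vᵀ * H * V).IsHermitian) {ζmin ζmax : ℝ}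
    (hζmin : IsSmallestEigenvalue (Vᵀ * H * V) ζmin)
    (hζmax : IsLargestEigenvalue (Vᵀ * H * V) ζmax) {v : Fin n → ℝ} (hv : q ⬝ᵥ v = 0) :
    ζmin * (v ⬝ᵥ v) ≤ v ⬝ᵥ H *ᵥ v ∧ v ⬝ᵥ H *ᵥ v ≤ ζmax * (v ⬝ᵥ v) := by
  obtain ⟨y, rfl⟩ := exists_mulVec_eq_of_dotProduct_eq_zero hq hVorth hVq hv
  have transfer (w : Fin n → ℝ) : V *ᵥ y ⬝ᵥ w = y ⬝ᵥ Vᵀ *ᵥ w := by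
    rw [dotProduct_mulVec, vecMul_transpose]
  have h1 : V *ᵥ y ⬝ᵥ V *ᵥ y = y ⬝ᵥ y := by
    rw [transfer, mulVec_mulVec, hVorth, one_mulVec]
  have h2 : V *ᵥ y ⬝ᵥ H *ᵥ V *ᵥ y = y ⬝ᵥ (Vᵀ * H * V) *ᵥ y := by
    rw [transfer, mulVec_mulVec, mulVec_mulVec, Matrix.mul_assoc]
  rw [h1, h2]
  exact ⟨hζmin.mul_dotProduct_le hHq y, hζmax.dotProduct_le_mul hHq y⟩

section FaceMinimizer

variable {n : ℕ} {H : Matrix (Fin n) (Fin n) ℝ} {c q l u x xb : Fin n → ℝ} {b : ℝ}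

lemma grad_dotProduct_eq_zero_of_isMinOn_face (hH : H.IsSymm)
    (hxbF : xb ∈ OmegaFace q b l u x)
    (hxbmin : ∀ v ∈ OmegaFace q b l u x, fObj H c xb ≤ fObj H c v) {d : Fin n → ℝ}
    (hd : d ∈ Omega0 q l u x) : grad H c xb ⬝ᵥ d = 0 := by
  have key : ∀ w ∈ Omega0 q l u x, 0 ≤ grad H c xb ⬝ᵥ w := by
    intro w hw
    refine linear_coeff_nonneg (b := 1 / 2 * (w ⬝ᵥ H *ᵥ w)) fun t _ _ => ?_
    have htw := Omega0.smul_mem hw t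
    have h := hxbmin (xb + t • w) ⟨by
      have h1 := hxbF.1
      have h2 := htw.1
      rw [dotp_eq_dotProduct] at *
      rw [dotProduct_add, h1, h2, add_zero], fun i hi => by
        rw [Pi.add_apply, hxbF.2 i hi, htw.2 i hi, add_zero]⟩
    rw [fObj_add hH] at h
    simp only [mulVec_smul, smul_dotProduct, dotProduct_smul, smul_eq_mul] at h
    linarith
  have h1 := key d hd
  have h2 := key _ (Omega0.smul_mem hd (-1))
  rw [dotProduct_smul, smul_eq_mul] at h2
  linarith

lemma ASet_subset_of_mem_face (hxbF : xb ∈ OmegaFace q b l u x) :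
    ASet l u x ⊆ ASet l u xb := by
  intro i hi
  have h := hxbF.2 i hi
  exact hi.imp (fun hl => h.trans hl) (fun hu => h.trans hu)

lemma phiVec_eq_zero_of_isMinOn_face (hH : H.IsSymm)
    (hxbF : xb ∈ OmegaFace q b l u x)
    (hxbmin : ∀ v ∈ OmegaFace q b l u x, fObj H c xb ≤ fObj H c v) :
    phiVec H c q l u xb = 0 := by
  have hφ := phiVec_mem_Omega0 H c q l u xb
  have h := grad_dotProduct_eq_zero_of_isMinOn_face (c := c) hH hxbF hxbmin
    ⟨hφ.1, fun i hi => hφ.2 i (ASet_subset_of_mem_face hxbF hi)⟩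
  rw [grad_dotProduct_of_mem_Omega0 H c hφ] at h
  exact dotProduct_self_eq_zero.1 h

lemma sub_mem_Omega0_of_mem_face (hx : x ∈ OmegaSet q b l u)
    (hxbF : xb ∈ OmegaFace q b l u x) : x - xb ∈ Omega0 q l u x := by
  refine ⟨?_, fun i hi => by simp [hxbF.2 i hi]⟩
  have h1 := hx.1
  have h2 := hxbF.1
  rw [dotp_eq_dotProduct] at *
  rw [dotProduct_sub, h1, h2, sub_self]

/-- Pushing a tangent direction at `x` far enough along `x - xb` makes it tangent at `xb`. -/
lemma exists_add_smul_sub_mem_TCone (hx : x ∈ OmegaSet q b l u)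
    (hxbF : xb ∈ OmegaFace q b l u x) {v : Fin n → ℝ} (hv : v ∈ TCone q l u x) :
    ∃ t : ℝ, v + t • (x - xb) ∈ TCone q l u xb := by
  have hd := sub_mem_Omega0_of_mem_face hx hxbF
  set t : ℝ := ∑ i, |v i| / |x i - xb i|
  have ht (i : Fin n) (hi : x i - xb i ≠ 0) : |v i| ≤ t * |x i - xb i| := by
    rw [← div_le_iff₀ (abs_pos.2 hi)]
    exact Finset.single_le_sum (f := fun i => |v i| / |x i - xb i|)
      (fun _ _ => by positivity) (Finset.mem_univ i)
  refine ⟨t, ?_, fun i hi => ?_, fun i hi => ?_⟩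
  · have h1 := hv.1
    have h2 := (Omega0.smul_mem hd t).1
    rw [dotp_eq_dotProduct] at *
    rw [dotProduct_add, h1, h2, add_zero]
  · change 0 ≤ v i + t * (x i - xb i)
    have hi' : xb i = l i := hi
    rcases (hx.2 i).1.eq_or_lt with h | h
    · rw [hi', h, sub_self, mul_zero, add_zero]
      exact hv.2.1 i h.symm
    · have hpos : 0 < x i - xb i := by linarith
      have := ht i hpos.ne'
      rw [abs_of_pos hpos] at this
      linarith [neg_abs_le (v i)]
  · change v i + t * (x i - xb i) ≤ 0
    have hi' : xb i = u i := hi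
    rcases (hx.2 i).2.eq_or_lt with h | h
    · rw [hi', h, sub_self, mul_zero, add_zero]
      exact hv.2.2 i h
    · have hneg : x i - xb i < 0 := by linarith
      have := ht i hneg.ne
      rw [abs_of_neg hneg] at this
      linarith [le_abs_self (v i)]

end FaceMinimizer

/-- if ‖β(x)‖_∞ > κ(H_q)^{1/2} ‖φ(x)‖₂ and x̄, the minimizer of f over Ω(x),
is feasible, then β(x̄) ≠ 0. -/
theorem stmt_9 {n : ℕ} (hn : 2 ≤ n)
    (H : Matrix (Fin n) (Fin n) ℝ) (hH : H.IsSymm)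
    (c q l u : Fin n → ℝ) (b : ℝ) (hlu : ∀ i, l i < u i) (hq : q ≠ 0)
    -- V has orthonormal columns spanning {q}ᗮ
    (V : Matrix (Fin n) (Fin (n - 1)) ℝ)
    (hVorth : Vᵀ * V = 1) (hVq : Matrix.vecMul q V = 0)
    -- H_q = VᵀHV positive definite, with extreme eigenvalues ζmin, ζmax
    (hHq : (Vᵀ * H * V).PosDef)
    (ζmin ζmax : ℝ)
    (hζmin : IsSmallestEigenvalue (Vᵀ * H * V) ζmin)
    (hζmax : IsLargestEigenvalue (Vᵀ * H * V) ζmax)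
    (x : Fin n → ℝ) (hx : x ∈ OmegaSet q b l u)
    (gP : Fin n → ℝ) (hgP : IsProjGrad H c q l u x gP)
    -- ‖β(x)‖_∞ > κ(H_q)^{1/2} ‖φ(x)‖₂
    (hdisp : (⨆ i : Fin n, |betaVec H c q l u x gP i|) >
        Real.sqrt (ζmax / ζmin) * nrm (phiVec H c q l u x))
    -- x̄ is the minimizer of f over Ω(x)
    (xb : Fin n → ℝ) (hxbF : xb ∈ OmegaFace q b l u x)
    (hxbmin : ∀ v ∈ OmegaFace q b l u x, fObj H c xb ≤ fObj H c v)
    -- x̄ ∈ Ω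
    (hxbO : xb ∈ OmegaSet q b l u)
    (gPb : Fin n → ℝ) (hgPb : IsProjGrad H c q l u xb gPb) :
    betaVec H c q l u xb gPb ≠ 0 := by
  intro hβ
  have hζmin0 : 0 < ζmin := hζmin.pos_of_posDef hHq
  have hζmax0 : 0 < ζmax := hζmin0.trans_le (hζmin.le_of_isLargestEigenvalue hζmax)
  have hbounds {v : Fin n → ℝ} (hv : dotp q v = 0) :=
    dotProduct_mulVec_bounds hq hVorth hVq hHq.isHermitian hζmin hζmax hv
  have hgb : gPb = 0 := by
    rwa [betaVec, phiVec_eq_zero_of_isMinOn_face hH hxbF hxbmin, sub_zero, neg_eq_zero] at hβ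
  set d := x - xb with hd_def
  have hd : d ∈ Omega0 q l u x := sub_mem_Omega0_of_mem_face hx hxbF
  have hgradd : grad H c xb ⬝ᵥ d = 0 :=
    grad_dotProduct_eq_zero_of_isMinOn_face hH hxbF hxbmin hd
  have hgradg : 0 ≤ grad H c xb ⬝ᵥ gP := by
    obtain ⟨t, ht⟩ := exists_add_smul_sub_mem_TCone hx hxbF hgP.1
    have h := hgPb.dotProduct_nonneg ht
    rwa [hgb, zero_add, dotProduct_add, dotProduct_smul, hgradd, smul_zero, add_zero] at h
  -- the decrease of `f` from `x` to `xb` dominates that of the best step along `gP`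
  have hlower : nrm gP ^ 2 / (2 * ζmax) ≤ fObj H c x - fObj H c xb := by
    have hw : dotp q (d + ζmax⁻¹ • gP) = 0 :=
      (TCone.add_mem (Omega0.mem_TCone hd)
        (TCone.smul_mem hgP.1 (inv_nonneg.2 hζmax0.le))).1
    have h1 := fObj_add hH c xb (d + ζmax⁻¹ • gP)
    have h2 := fObj_add hH c x (ζmax⁻¹ • gP)
    have h3 : xb + (d + ζmax⁻¹ • gP) = x + ζmax⁻¹ • gP := by
      rw [hd_def]; abel
    have h4 := (mul_nonneg hζmin0.le (dotProduct_self_nonneg_real _)).trans (hbounds hw).1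
    have h5 := (hbounds hgP.1.1).2
    rw [h3, dotProduct_add, hgradd, dotProduct_smul, smul_eq_mul] at h1
    simp only [mulVec_smul, smul_dotProduct, dotProduct_smul, smul_eq_mul,
      hgP.grad_dotProduct_self] at h2
    rw [← nrm_sq] at h2 h5
    have h6 : 0 ≤ ζmax⁻¹ * (grad H c xb ⬝ᵥ gP) := by positivity
    have h7 : ζmax⁻¹ * (ζmax⁻¹ * (gP ⬝ᵥ H *ᵥ gP)) ≤ ζmax⁻¹ * nrm gP ^ 2 := by
      gcongr
      rwa [inv_mul_le_iff₀ hζmax0]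
    have h8 : nrm gP ^ 2 / (2 * ζmax) = ζmax⁻¹ * nrm gP ^ 2 / 2 := by
      field_simp
    linarith
  have hupper : fObj H c x - fObj H c xb ≤ nrm (phiVec H c q l u x) ^ 2 / (2 * ζmin) := by
    have h1 := fObj_add hH c x (-d)
    have h2 := (hbounds hd.1).1
    have h3 := dotProduct_self_nonneg_real (phiVec H c q l u x - ζmin • d)
    rw [show x + -d = xb by rw [hd_def]; abel, dotProduct_neg, mulVec_neg, neg_dotProduct_neg,
      grad_dotProduct_of_mem_Omega0 H c hd] at h1
    simp only [sub_dotProduct, dotProduct_sub, smul_dotProduct, dotProduct_smul, smul_eq_mul,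
      dotProduct_comm d] at h3
    rw [nrm_sq, le_div_iff₀ (by positivity)]
    nlinarith
  have hg : nrm gP ≤ √(ζmax / ζmin) * nrm (phiVec H c q l u x) := by
    refine abs_le_of_sq_le_sq' ?_ (by have := nrm_nonneg (phiVec H c q l u x); positivity) |>.2
    rw [mul_pow, Real.sq_sqrt (by positivity)]
    have h := hlower.trans hupper
    rw [div_le_iff₀ (by positivity)] at h
    refine h.trans_eq ?_
    field_simp
  have : Nonempty (Fin n) := ⟨⟨0, by omega⟩⟩
  exact hdisp.not_ge <| ciSup_le fun i =>
    (abs_apply_le_nrm _ i).trans (hgP.nrm_betaVec_le.trans hg)
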